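/- Let d ≥ 1 and let μ_d be the uniform probability measure on the closed unit ball B^d of ℝ^d. Then the integral over (R₁, R₂) ∈ [0,1]^d × [0,1]^d (with respect to the uniform product measure) of the supremum over R̂₁, R̂₂ ∈ {0,1}^d of [ μ_d{r : R₁·r > R₂·r and R̂₁·r > R̂₂·r} + μ_d{r : R₂·r > R₁·r and R̂₂·r > R̂₁·r} ] equals the integral over (R₁, R₂) ∈ [0,1]^d × [0,1]^d of [ 1 − arccos( max_{1≤j≤d} (Σ_{i=1}^j |R₁−R₂|_{(i)})/(√j·‖R₁−R₂‖₂) )/π ], where |R₁−R₂|_{(i)} denotes the i-th largest value among the absolute values of the coordinates of R₁−R₂. -/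

import Mathlib

open MeasureTheory
open scoped RealInnerProductSpace

/-- The uniform probability measure on the closed unit ball of `ℝ^d`. -/
noncomputable def unifBall (d : ℕ) : Measure (EuclideanSpace ℝ (Fin d)) :=
  (volume (Metric.closedBall (0 : EuclideanSpace ℝ (Fin d)) 1))⁻¹ •
    volume.restrict (Metric.closedBall (0 : EuclideanSpace ℝ (Fin d)) 1)

/-- The unit cube `[0,1]^d` in `ℝ^d`; Lebesgue measure restricted to it is the uniform
probability measure on the cube. -/
def unitCube (d : ℕ) : Set (EuclideanSpace ℝ (Fin d)) :=
  {x | ∀ i, x i ∈ Set.Icc (0:ℝ) 1}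

/-- `topAbsSum w j` is the sum of the `j` largest absolute values of the coordinates of
`w`, i.e. `Σ_{i=1}^j |w|_{(i)}`. -/
noncomputable def topAbsSum {d : ℕ} (w : EuclideanSpace ℝ (Fin d)) (j : ℕ) : ℝ :=
  sSup {s : ℝ | ∃ S : Finset (Fin d), S.card = j ∧ s = ∑ i ∈ S, |w i|}

open InnerProductGeometry

section helpers

variable {d : ℕ}

local notation "E" => EuclideanSpace ℝ (Fin d)

lemma unifBall_isProb : IsProbabilityMeasure (unifBall d) := by
  constructor
  unfold unifBall
  rw [Measure.smul_apply, Measure.restrict_apply MeasurableSet.univ, Set.univ_inter, smul_eq_mul]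
  apply ENNReal.inv_mul_cancel
  · exact (Metric.measure_closedBall_pos volume _ one_pos).ne'
  · exact measure_closedBall_lt_top.ne

lemma unifBall_preserve (L : E ≃ₗᵢ[ℝ] E) (s : Set E) (hs : MeasurableSet s) :
    unifBall d (L ⁻¹' s) = unifBall d s := by
  unfold unifBall
  rw [Measure.smul_apply, Measure.smul_apply, Measure.restrict_apply hs,
    Measure.restrict_apply (L.continuous.measurable hs)]
  congr 1
  rw [← L.measurePreserving.measure_preimage (hs.inter
    Metric.isClosed_closedBall.measurableSet).nullMeasurableSet, Set.preimage_inter]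
  congr 2
  ext x
  simp

lemma unifBall_hyper (v : E) (hv : v ≠ 0) : unifBall d {r | ⟪v, r⟫ = 0} = 0 := by
  unfold unifBall
  rw [Measure.smul_apply, smul_eq_mul]
  apply mul_eq_zero_of_right
  apply le_antisymm _ zero_le
  refine (Measure.restrict_apply_le _ _).trans ?_
  have h : {r : E | ⟪v, r⟫ = 0} = ((LinearMap.ker (innerSL ℝ v).toLinearMap : Submodule ℝ E) : Set E) := by
    ext r; simp
  rw [h, Measure.addHaar_submodule]
  intro h'
  have : v ∈ LinearMap.ker (innerSL ℝ v).toLinearMap := by rw [h']; trivial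
  simp at this
  exact hv this

/-- rotation in the plane spanned by an orthonormal pair -/
lemma exists_rot (e₁ e₂ : E) (h1 : ⟪e₁, e₁⟫ = 1) (h2 : ⟪e₂, e₂⟫ = 1) (h12 : ⟪e₁, e₂⟫ = 0) (t : ℝ) :
    ∃ L : E ≃ₗᵢ[ℝ] E, ∀ x,
      ⟪e₁, L x⟫ = Real.cos t * ⟪e₁, x⟫ - Real.sin t * ⟪e₂, x⟫ ∧
      ⟪e₂, L x⟫ = Real.cos t * ⟪e₂, x⟫ + Real.sin t * ⟪e₁, x⟫ := by
  have h21 : ⟪e₂, e₁⟫ = 0 := by rw [real_inner_comm]; exact h12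
  let f : E →ₗ[ℝ] E := LinearMap.id
    + ((Real.cos t - 1) • (innerSL ℝ e₁).toLinearMap - Real.sin t • (innerSL ℝ e₂).toLinearMap).smulRight e₁
    + ((Real.cos t - 1) • (innerSL ℝ e₂).toLinearMap + Real.sin t • (innerSL ℝ e₁).toLinearMap).smulRight e₂
  have hf : ∀ x, f x = x + ((Real.cos t - 1) * ⟪e₁, x⟫ - Real.sin t * ⟪e₂, x⟫) • e₁
      + ((Real.cos t - 1) * ⟪e₂, x⟫ + Real.sin t * ⟪e₁, x⟫) • e₂ := by
    intro x; simp [f]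
  have hn : ∀ x, ‖f x‖ = ‖x‖ := by
    intro x
    rw [← sq_eq_sq₀ (norm_nonneg _) (norm_nonneg _), ← real_inner_self_eq_norm_sq,
      ← real_inner_self_eq_norm_sq, hf]
    simp only [inner_add_left, inner_add_right, real_inner_smul_left, real_inner_smul_right,
      h1, h2, h12, h21, real_inner_comm e₁ x, real_inner_comm e₂ x]
    have := Real.sin_sq_add_cos_sq t
    rw [real_inner_comm x e₁, real_inner_comm x e₂]
    linear_combination (⟪x, e₁⟫ ^ 2 + ⟪x, e₂⟫ ^ 2) * this
  refine ⟨LinearIsometry.toLinearIsometryEquiv ⟨f, hn⟩ rfl, fun x => ?_⟩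
  have : (LinearIsometry.toLinearIsometryEquiv ⟨f, hn⟩ rfl) x = f x := rfl
  rw [this, hf]
  simp only [inner_add_right, real_inner_smul_right, h1, h2, h12, h21]
  constructor <;> ring

lemma half_meas (v : E) (hv : v ≠ 0) : (unifBall d).real {r | 0 < ⟪v, r⟫} = 1 / 2 := by
  have : IsProbabilityMeasure (unifBall d) := unifBall_isProb
  have hm : MeasurableSet {r : E | 0 < ⟪v, r⟫} := measurableSet_lt (by fun_prop) (by fun_prop)
  have hm' : MeasurableSet {r : E | ⟪v, r⟫ < 0} := measurableSet_lt (by fun_prop) (by fun_prop)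
  have e1 : (unifBall d).real {r | ⟪v, r⟫ < 0} = (unifBall d).real {r | 0 < ⟪v, r⟫} := by
    unfold Measure.real
    rw [← unifBall_preserve (LinearIsometryEquiv.neg ℝ) _ hm]
    congr 2
    ext r; simp
  have e2 := probReal_add_probReal_compl (μ := unifBall d) hm
  have e3 : (unifBall d).real {r | 0 < ⟪v, r⟫}ᶜ = (unifBall d).real {r | ⟪v, r⟫ < 0} := by
    apply measureReal_congr
    have h0 : ∀ᵐ r ∂(unifBall d), ⟪v, r⟫ ≠ 0 := by
      rw [ae_iff]; simpa using unifBall_hyper v hv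
    filter_upwards [h0] with r hr
    apply propext
    change (¬ (0 < ⟪v, r⟫)) ↔ ⟪v, r⟫ < 0
    rw [not_lt]
    exact ⟨fun h => lt_of_le_of_ne h hr, le_of_lt⟩
  linarith

lemma pair_meas (a b : E) : MeasurableSet {r : E | 0 < ⟪a, r⟫ ∧ ⟪b, r⟫ < 0} := by
  have h1 : MeasurableSet {r : E | 0 < ⟪a, r⟫} := measurableSet_lt (by fun_prop) (by fun_prop)
  have h2 : MeasurableSet {r : E | ⟪b, r⟫ < 0} := measurableSet_lt (by fun_prop) (by fun_prop)
  exact h1.inter h2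

/-- monotone additive functions on `[0, c]` are linear -/
lemma cauchy_lin (G : ℝ → ℝ) (c : ℝ) (hc : 0 < c) (h0 : ∀ x, 0 ≤ G x)
    (hz : G 0 = 0)
    (hadd : ∀ x y, 0 < x → 0 < y → x + y ≤ c → G (x + y) = G x + G y)
    (x : ℝ) (hx0 : 0 ≤ x) (hx : x ≤ c) : G x = x / c * G c := by
  have hadd' : ∀ x y, 0 ≤ x → 0 ≤ y → x + y ≤ c → G (x + y) = G x + G y := by
    intro x y hx hy hxy
    rcases hx.eq_or_lt with rfl | hx
    · simp [hz]
    rcases hy.eq_or_lt with rfl | hy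
    · simp [hz]
    exact hadd x y hx hy hxy
  have hmono : ∀ x y, 0 ≤ x → x ≤ y → y ≤ c → G x ≤ G y := by
    intro x y hx hxy hy
    have := hadd' x (y - x) hx (by linarith) (by linarith)
    rw [add_sub_cancel] at this
    linarith [h0 (y - x)]
  have hk : ∀ (k : ℕ) (y : ℝ), 0 ≤ y → k * y ≤ c → G (k * y) = k * G y := by
    intro k y hy
    induction k with
    | zero => intro _; simp [hz]
    | succ k ih =>
      intro h
      push_cast at h ⊢
      have hky : (0:ℝ) ≤ k * y := by positivity
      rw [add_mul, one_mul, hadd' _ _ hky hy (by linarith), ih (by linarith)]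
      ring
  have hbd : ∀ n : ℕ, 0 < n → |G x - x / c * G c| * n ≤ G c := by
    intro n hn
    have hn' : (0:ℝ) < n := by exact_mod_cast hn
    have hGn : G c = n * G (c / n) := by
      rw [← hk n (c / n) (by positivity) (by field_simp; rfl)]
      congr 1; field_simp
    have hcn : 0 < c / n := by positivity
    set k := ⌊x / (c / n)⌋₊ with hkdef
    have hk1 : (k:ℝ) ≤ x / (c / n) := Nat.floor_le (by positivity)
    have hk2 : x / (c / n) < k + 1 := Nat.lt_floor_add_one _
    have hk1' : k * (c / n) ≤ x := by rwa [le_div_iff₀ hcn] at hk1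
    have hk2' : x < (k + 1) * (c / n) := by rwa [div_lt_iff₀ hcn] at hk2
    have hg := h0 (c / n)
    have l1 : k * G (c / n) ≤ G x := by
      rw [← hk k _ hcn.le (by linarith)]
      exact hmono _ _ (by positivity) hk1' hx
    have l2 : G x ≤ (k + 1) * G (c / n) := by
      by_cases hle : (k + 1) * (c / n) ≤ c
      · have := hk (k + 1) (c / n) hcn.le (by push_cast; exact hle)
        push_cast at this
        rw [← this]
        exact hmono _ _ hx0 hk2'.le hle
      · have : (n:ℝ) < k + 1 := by
          by_contra hcon
          push Not at hcon
          apply hle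
          calc (k + 1) * (c / n) ≤ n * (c / n) := by gcongr
            _ = c := by field_simp
        have := hmono x c hx0 hx le_rfl
        rw [hGn] at this
        nlinarith
    have e : x / c * G c = (x / (c / n)) * G (c / n) := by
      rw [hGn]; field_simp
    rw [e]
    have l3 : k * G (c / n) ≤ (x / (c / n)) * G (c / n) := by gcongr
    have l4 : (x / (c / n)) * G (c / n) ≤ (k + 1) * G (c / n) := by gcongr
    rw [hGn, mul_comm]
    gcongr
    rw [abs_le]; constructor <;> linarith
  by_contra hne
  have hpos : 0 < |G x - x / c * G c| := abs_pos.mpr (sub_ne_zero.mpr hne)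
  obtain ⟨n, hn⟩ := exists_nat_gt (G c / |G x - x / c * G c|)
  have hn0 : 0 < n := by
    have : (0:ℝ) < n := lt_of_le_of_lt (div_nonneg (h0 c) hpos.le) hn
    exact_mod_cast this
  have := hbd n hn0
  rw [div_lt_iff₀ hpos] at hn
  linarith

lemma lune (e₁ e₂ : E) (h1 : ⟪e₁, e₁⟫ = 1) (h2 : ⟪e₂, e₂⟫ = 1) (h12 : ⟪e₁, e₂⟫ = 0)
    (θ : ℝ) (h0 : 0 ≤ θ) (hθ : θ ≤ Real.pi) :
    (unifBall d).real {r | 0 < ⟪e₁, r⟫ ∧ Real.cos θ * ⟪e₁, r⟫ + Real.sin θ * ⟪e₂, r⟫ < 0}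
      = θ / (2 * Real.pi) := by
  have : IsProbabilityMeasure (unifBall d) := unifBall_isProb
  have he1 : e₁ ≠ 0 := by rintro rfl; simp at h1
  have h21 : ⟪e₂, e₁⟫ = 0 := by rw [real_inner_comm]; exact h12
  have hpi := Real.pi_pos
  set G : ℝ → ℝ := fun θ =>
    (unifBall d).real {r | 0 < ⟪e₁, r⟫ ∧ Real.cos θ * ⟪e₁, r⟫ + Real.sin θ * ⟪e₂, r⟫ < 0} with hG
  have hGpi : G Real.pi = 1 / 2 := by
    rw [← half_meas e₁ he1]
    simp only [hG]
    congr 1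
    ext r; simp
  have hGz : G 0 = 0 := by
    simp only [hG]
    convert measureReal_empty using 2
    ext r; simp; intro h; exact h.le
  have key := cauchy_lin G Real.pi hpi (fun x => measureReal_nonneg) hGz ?_ θ h0 hθ
  · change G θ = _
    rw [key, hGpi]; field_simp
  intro x y hx hy hxy
  obtain ⟨L, hL⟩ := exists_rot e₁ e₂ h1 h2 h12 x
  have hms : ∀ a b a' b' : ℝ, MeasurableSet {r : E | 0 < a * ⟪e₁, r⟫ + b * ⟪e₂, r⟫ ∧
      a' * ⟪e₁, r⟫ + b' * ⟪e₂, r⟫ < 0} := by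
    intro a b a' b'
    have := pair_meas (a • e₁ + b • e₂) (a' • e₁ + b' • e₂)
    simpa only [inner_add_left, real_inner_smul_left] using this
  have hGy : G y = (unifBall d).real {r | 0 < Real.cos x * ⟪e₁, r⟫ + Real.sin x * ⟪e₂, r⟫ ∧
      Real.cos (x + y) * ⟪e₁, r⟫ + Real.sin (x + y) * ⟪e₂, r⟫ < 0} := by
    simp only [hG, Measure.real]
    rw [← unifBall_preserve L _ (hms _ _ _ _)]
    congr 2
    ext r
    obtain ⟨q1, q2⟩ := hL r
    simp only [Set.preimage_ofPred_eq, Set.mem_ofPred_eq, q1, q2]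
    have hs := Real.sin_sq_add_cos_sq x
    have w1 : Real.cos x * (Real.cos x * ⟪e₁, r⟫ - Real.sin x * ⟪e₂, r⟫) +
        Real.sin x * (Real.cos x * ⟪e₂, r⟫ + Real.sin x * ⟪e₁, r⟫) = ⟪e₁, r⟫ := by
      linear_combination ⟪e₁, r⟫ * hs
    have w2 : Real.cos (x + y) * (Real.cos x * ⟪e₁, r⟫ - Real.sin x * ⟪e₂, r⟫) +
        Real.sin (x + y) * (Real.cos x * ⟪e₂, r⟫ + Real.sin x * ⟪e₁, r⟫)
        = Real.cos y * ⟪e₁, r⟫ + Real.sin y * ⟪e₂, r⟫ := by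
      rw [Real.cos_add, Real.sin_add]
      linear_combination (Real.cos y * ⟪e₁, r⟫ + Real.sin y * ⟪e₂, r⟫) * hs
    rw [w1, w2]
  rw [hGy]
  simp only [hG]
  rw [← measureReal_union _ (hms _ _ _ _)]
  · apply measureReal_congr
    have hv : Real.cos x • e₁ + Real.sin x • e₂ ≠ 0 := by
      intro h
      have := congrArg (fun z => ⟪z, z⟫) h
      simp only [inner_add_left, inner_add_right, real_inner_smul_left, real_inner_smul_right,
        h1, h2, h12, h21, inner_zero_left] at this
      have hs := Real.sin_sq_add_cos_sq x
      nlinarith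
    have hae : ∀ᵐ r ∂(unifBall d), ⟪Real.cos x • e₁ + Real.sin x • e₂, r⟫ ≠ 0 := by
      rw [ae_iff]; simpa using unifBall_hyper _ hv
    filter_upwards [hae] with r hr
    simp only [inner_add_left, real_inner_smul_left] at hr
    apply propext
    change (0 < ⟪e₁, r⟫ ∧ Real.cos (x + y) * ⟪e₁, r⟫ + Real.sin (x + y) * ⟪e₂, r⟫ < 0) ↔
      ((0 < ⟪e₁, r⟫ ∧ Real.cos x * ⟪e₁, r⟫ + Real.sin x * ⟪e₂, r⟫ < 0) ∨
      (0 < Real.cos x * ⟪e₁, r⟫ + Real.sin x * ⟪e₂, r⟫ ∧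
        Real.cos (x + y) * ⟪e₁, r⟫ + Real.sin (x + y) * ⟪e₂, r⟫ < 0))
    have sx : 0 < Real.sin x := Real.sin_pos_of_pos_of_lt_pi hx (by linarith)
    have sy : 0 < Real.sin y := Real.sin_pos_of_pos_of_lt_pi hy (by linarith)
    have sxy : 0 ≤ Real.sin (x + y) := Real.sin_nonneg_of_nonneg_of_le_pi (by linarith) hxy
    have rel : Real.sin y * ⟪e₁, r⟫ +
        Real.sin x * (Real.cos (x + y) * ⟪e₁, r⟫ + Real.sin (x + y) * ⟪e₂, r⟫)
        = Real.sin (x + y) * (Real.cos x * ⟪e₁, r⟫ + Real.sin x * ⟪e₂, r⟫) := by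
      rw [Real.cos_add, Real.sin_add]
      linear_combination (-Real.sin y * ⟪e₁, r⟫) * (Real.sin_sq_add_cos_sq x)
    generalize Real.cos (x + y) * ⟪e₁, r⟫ + Real.sin (x + y) * ⟪e₂, r⟫ = C at *
    generalize Real.cos x * ⟪e₁, r⟫ + Real.sin x * ⟪e₂, r⟫ = B at *
    generalize ⟪e₁, r⟫ = A at *
    constructor
    · rintro ⟨hA, hC⟩
      rcases lt_or_gt_of_ne hr with h | h
      · exact Or.inl ⟨hA, h⟩
      · exact Or.inr ⟨h, hC⟩
    · rintro (⟨hA, hB⟩ | ⟨hB, hC⟩)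
      · refine ⟨hA, ?_⟩
        by_contra hC
        push Not at hC
        nlinarith [mul_pos sy hA, mul_nonneg sx.le hC, mul_nonneg sxy (neg_nonneg.mpr hB.le)]
      · refine ⟨?_, hC⟩
        by_contra hA
        push Not at hA
        nlinarith [mul_nonneg sy.le (neg_nonneg.mpr hA), mul_pos sx (neg_pos.mpr hC),
          mul_nonneg sxy hB.le]
  · rw [Set.disjoint_left]
    rintro r ⟨_, h⟩ ⟨h', _⟩
    linarith

lemma quadrant (w v : E) (hw : w ≠ 0) (hv : v ≠ 0) :
    (unifBall d).real {r | 0 < ⟪w, r⟫ ∧ 0 < ⟪v, r⟫} = 1 / 2 - angle w v / (2 * Real.pi) := by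
  have : IsProbabilityMeasure (unifBall d) := unifBall_isProb
  have hpi := Real.pi_pos
  have hwn : 0 < ‖w‖ := norm_pos_iff.mpr hw
  have hvn : 0 < ‖v‖ := norm_pos_iff.mpr hv
  by_cases hs : Real.sin (angle w v) = 0
  · rcases InnerProductGeometry.sin_eq_zero_iff_angle_eq_zero_or_angle_eq_pi.mp hs with h | h
    · rw [h]
      obtain ⟨_, r, hr, rfl⟩ := InnerProductGeometry.angle_eq_zero_iff.mp h
      rw [zero_div, sub_zero, ← half_meas w hw]
      congr 1
      ext x
      simp [real_inner_smul_left, hr]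
    · rw [h]
      obtain ⟨_, r, hr, rfl⟩ := InnerProductGeometry.angle_eq_pi_iff.mp h
      have : (1:ℝ) / 2 - Real.pi / (2 * Real.pi) = 0 := by field_simp; ring
      rw [this]
      convert measureReal_empty using 2
      ext x
      simp only [Set.mem_ofPred_eq, real_inner_smul_left, Set.mem_empty_iff_false, iff_false, not_and,
        not_lt]
      intro h
      nlinarith
  · set θ := angle w v with hθ
    have hcos : Real.cos θ * (‖w‖ * ‖v‖) = ⟪w, v⟫ := cos_angle_mul_norm_mul_norm w v
    have hsq := Real.sin_sq_add_cos_sq θ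
    let e₁ : E := ‖w‖⁻¹ • w
    let e₂ : E := (Real.sin θ)⁻¹ • (‖v‖⁻¹ • v - Real.cos θ • e₁)
    have hwe : w = ‖w‖ • e₁ := by simp [e₁, smul_smul, hwn.ne']
    have hve : v = ‖v‖ • (Real.cos θ • e₁ + Real.sin θ • e₂) := by
      simp only [e₂]
      rw [smul_smul (Real.sin θ), mul_inv_cancel₀ hs, one_smul, add_sub_cancel, smul_smul,
        mul_inv_cancel₀ hvn.ne', one_smul]
    have h1 : ⟪e₁, e₁⟫ = 1 := by
      simp only [e₁, real_inner_smul_left, real_inner_smul_right]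
      rw [real_inner_self_eq_norm_sq]
      field_simp
    have h1v : ⟪e₁, v⟫ = Real.cos θ * ‖v‖ := by
      simp only [e₁, real_inner_smul_left, ← hcos]
      field_simp
    have h12 : ⟪e₁, e₂⟫ = 0 := by
      simp only [e₂, real_inner_smul_right, inner_sub_right, h1, h1v]
      field_simp
      ring
    have h2 : ⟪e₂, e₂⟫ = 1 := by
      have hvv : ⟪v, v⟫ = ‖v‖ ^ 2 := real_inner_self_eq_norm_sq v
      have hv1 : ⟪v, e₁⟫ = Real.cos θ * ‖v‖ := by rw [real_inner_comm]; exact h1v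
      simp only [e₂, real_inner_smul_right, real_inner_smul_left, inner_sub_right, inner_sub_left,
        h1, h1v, hv1, hvv]
      field_simp
      linear_combination -hsq
    have hl := lune e₁ e₂ h1 h2 h12 θ (angle_nonneg _ _) (angle_le_pi _ _)
    have hset : {r : E | 0 < ⟪e₁, r⟫ ∧ Real.cos θ * ⟪e₁, r⟫ + Real.sin θ * ⟪e₂, r⟫ < 0}
        = {r | 0 < ⟪w, r⟫ ∧ ⟪v, r⟫ < 0} := by
      ext r
      have a1 : ⟪w, r⟫ = ‖w‖ * ⟪e₁, r⟫ := by
        conv_lhs => rw [hwe]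
        rw [real_inner_smul_left]
      have a2 : ⟪v, r⟫ = ‖v‖ * (Real.cos θ * ⟪e₁, r⟫ + Real.sin θ * ⟪e₂, r⟫) := by
        conv_lhs => rw [hve]
        simp only [real_inner_smul_left, inner_add_left]
      simp only [Set.mem_ofPred_eq, a1, a2, mul_pos_iff_of_pos_left hwn]
      apply and_congr_right
      intro _
      constructor
      · intro h; exact mul_neg_of_pos_of_neg hvn h
      · intro h; by_contra h'; push Not at h'; nlinarith [mul_nonneg hvn.le h']
    rw [hset] at hl
    rw [← half_meas w hw, ← hl]
    rw [eq_sub_iff_add_eq, ← measureReal_union]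
    · apply measureReal_congr
      have hae : ∀ᵐ r ∂(unifBall d), ⟪v, r⟫ ≠ 0 := by
        rw [ae_iff]; simpa using unifBall_hyper _ hv
      filter_upwards [hae] with r hr
      apply propext
      change ((0 < ⟪w, r⟫ ∧ 0 < ⟪v, r⟫) ∨ (0 < ⟪w, r⟫ ∧ ⟪v, r⟫ < 0)) ↔ 0 < ⟪w, r⟫
      rw [← and_or_left]
      exact and_iff_left hr.lt_or_gt.symm
    · rw [Set.disjoint_left]
      rintro r ⟨_, h⟩ ⟨_, h'⟩
      linarith
    · exact pair_meas w v

lemma acc_value (R₁ R₂ S₁ S₂ : E) (hR : R₁ - R₂ ≠ 0) (hS : S₁ - S₂ ≠ 0) :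
    (unifBall d {r | ⟪R₁, r⟫ > ⟪R₂, r⟫ ∧ ⟪S₁, r⟫ > ⟪S₂, r⟫}).toReal +
      (unifBall d {r | ⟪R₂, r⟫ > ⟪R₁, r⟫ ∧ ⟪S₂, r⟫ > ⟪S₁, r⟫}).toReal
    = 1 - Real.arccos (⟪R₁ - R₂, S₁ - S₂⟫ / (‖R₁ - R₂‖ * ‖S₁ - S₂‖)) / Real.pi := by
  have a := quadrant _ _ hR hS
  have b := quadrant (-(R₁ - R₂)) (-(S₁ - S₂)) (neg_ne_zero.mpr hR) (neg_ne_zero.mpr hS)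
  rw [angle_neg_neg] at b
  simp only [inner_sub_left, sub_pos, neg_sub] at a b
  change (unifBall d).real _ + (unifBall d).real _ = _
  simp only [gt_iff_lt]
  rw [a, b]
  unfold InnerProductGeometry.angle
  have := Real.pi_pos
  field_simp
  ring

lemma topAbs_finite (w : E) (j : ℕ) :
    {s : ℝ | ∃ S : Finset (Fin d), S.card = j ∧ s = ∑ i ∈ S, |w i|}.Finite := by
  apply (Set.finite_range (fun S : Finset (Fin d) => ∑ i ∈ S, |w i|)).subset
  rintro s ⟨S, _, rfl⟩
  exact ⟨S, rfl⟩

lemma le_topAbs (w : E) (S : Finset (Fin d)) : ∑ i ∈ S, |w i| ≤ topAbsSum w S.card :=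
  le_csSup (topAbs_finite w _).bddAbove ⟨S, rfl, rfl⟩

lemma topAbs_attained (w : E) (j : ℕ) (hj : j ≤ d) :
    ∃ S : Finset (Fin d), S.card = j ∧ topAbsSum w j = ∑ i ∈ S, |w i| := by
  have hne : {s : ℝ | ∃ S : Finset (Fin d), S.card = j ∧ s = ∑ i ∈ S, |w i|}.Nonempty := by
    obtain ⟨S, _, hS⟩ := Finset.exists_subset_card_eq (s := (Finset.univ : Finset (Fin d)))
      (n := j) (by simpa using hj)
    exact ⟨_, S, hS, rfl⟩
  exact hne.csSup_mem (topAbs_finite w j)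

lemma pointwise (hd : 1 ≤ d) (R₁ R₂ : E) (hR : R₁ - R₂ ≠ 0) :
      sSup {b : ℝ | ∃ Rh₁ Rh₂ : EuclideanSpace ℝ (Fin d),
        (∀ i, Rh₁ i = 0 ∨ Rh₁ i = 1) ∧ (∀ i, Rh₂ i = 0 ∨ Rh₂ i = 1) ∧
        b = (unifBall d {r | ⟪R₁, r⟫ > ⟪R₂, r⟫ ∧ ⟪Rh₁, r⟫ > ⟪Rh₂, r⟫}).toReal +
            (unifBall d {r | ⟪R₂, r⟫ > ⟪R₁, r⟫ ∧ ⟪Rh₂, r⟫ > ⟪Rh₁, r⟫}).toReal} =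
      1 - Real.arccos (sSup {c : ℝ | ∃ j ∈ Finset.Icc 1 d,
        c = topAbsSum (R₁ - R₂) j / (Real.sqrt (j : ℝ) * ‖R₁ - R₂‖)}) / Real.pi := by
  have hpi := Real.pi_pos
  set C := {c : ℝ | ∃ j ∈ Finset.Icc 1 d,
        c = topAbsSum (R₁ - R₂) j / (Real.sqrt (j : ℝ) * ‖R₁ - R₂‖)} with hC
  have hwn : 0 < ‖R₁ - R₂‖ := norm_pos_iff.mpr hR
  have hCf : C.Finite := by
    apply ((Finset.Icc 1 d).finite_toSet.image
      (fun j : ℕ => topAbsSum (R₁ - R₂) j / (Real.sqrt (j : ℝ) * ‖R₁ - R₂‖))).subset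
    rintro c ⟨j, hj, rfl⟩
    exact ⟨j, hj, rfl⟩
  have hCn : C.Nonempty := ⟨_, 1, by simp [hd], rfl⟩
  apply IsGreatest.csSup_eq
  constructor
  · obtain ⟨j, hj, hjM⟩ := hCn.csSup_mem hCf
    rw [hjM]
    rw [Finset.mem_Icc] at hj
    obtain ⟨S, hSc, hS⟩ := topAbs_attained (R₁ - R₂) j hj.2
    let S₁ : E := WithLp.toLp 2 (fun i => if i ∈ S ∧ 0 ≤ (R₁ - R₂) i then 1 else 0)
    let S₂ : E := WithLp.toLp 2 (fun i => if i ∈ S ∧ ¬ 0 ≤ (R₁ - R₂) i then 1 else 0)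
    have hn : ‖S₁ - S₂‖ = Real.sqrt j := by
      rw [EuclideanSpace.norm_eq]
      congr 1
      rw [← hSc, Finset.card_eq_sum_ones, Nat.cast_sum, ← Finset.sum_subset (Finset.subset_univ S)]
      · apply Finset.sum_congr rfl
        intro i hi
        by_cases h : R₂ i ≤ R₁ i
        · simp [S₁, S₂, hi, h, not_lt.mpr h]
        · simp [S₁, S₂, hi, h, not_le.mp h]
      · intro i _ hi
        simp [S₁, S₂, hi]
    have hin : ⟪R₁ - R₂, S₁ - S₂⟫ = ∑ i ∈ S, |(R₁ - R₂) i| := by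
      rw [PiLp.inner_apply, ← Finset.sum_subset (Finset.subset_univ S)]
      · apply Finset.sum_congr rfl
        intro i hi
        by_cases h : R₂ i ≤ R₁ i
        · simp [S₁, S₂, hi, h, not_lt.mpr h, abs_of_nonneg (sub_nonneg.mpr h)]
        · simp [S₁, S₂, hi, h, not_le.mp h, abs_of_neg (sub_neg.mpr (not_le.mp h))]
      · intro i _ hi
        simp [S₁, S₂, hi]
    have hjpos : (0:ℝ) < j := by exact_mod_cast hj.1
    have hne : S₁ - S₂ ≠ 0 := by
      rw [← norm_pos_iff, hn]; exact Real.sqrt_pos.mpr hjpos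
    refine ⟨S₁, S₂, ?_, ?_, ?_⟩
    · intro i
      simp only [S₁]
      split_ifs <;> simp
    · intro i
      simp only [S₂]
      split_ifs <;> simp
    · rw [acc_value _ _ _ _ hR hne, hin, hn, hS, mul_comm]
  · rintro b ⟨S₁, S₂, h₁, h₂, rfl⟩
    by_cases hne : S₁ - S₂ = 0
    · rw [sub_eq_zero] at hne
      subst hne
      simp only [gt_iff_lt, lt_irrefl, and_false, Set.ofPred_false, measure_empty,
        ENNReal.toReal_zero, add_zero]
      rw [sub_nonneg, div_le_one hpi]
      exact Real.arccos_le_pi _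
    · rw [acc_value _ _ _ _ hR hne]
      gcongr
      let S : Finset (Fin d) := Finset.univ.filter (fun i => (S₁ - S₂) i ≠ 0)
      have hval : ∀ i, (S₁ - S₂) i = 0 ∨ |(S₁ - S₂) i| = 1 := by
        intro i
        rcases h₁ i with h | h <;> rcases h₂ i with h' | h' <;> simp [h, h']
      have hn : ‖S₁ - S₂‖ = Real.sqrt S.card := by
        rw [EuclideanSpace.norm_eq]
        congr 1
        rw [Finset.card_eq_sum_ones, Nat.cast_sum, ← Finset.sum_subset (Finset.subset_univ S)]
        · apply Finset.sum_congr rfl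
          intro i hi
          rcases hval i with h | h
          · exact absurd h (Finset.mem_filter.mp hi).2
          · rw [Real.norm_eq_abs, h]; simp
        · intro i _ hi
          simp only [S, Finset.mem_filter, Finset.mem_univ, true_and, not_not] at hi
          rw [hi]; simp
      have hin : ⟪R₁ - R₂, S₁ - S₂⟫ ≤ ∑ i ∈ S, |(R₁ - R₂) i| := by
        rw [PiLp.inner_apply, ← Finset.sum_subset (Finset.subset_univ S)]
        · apply Finset.sum_le_sum
          intro i hi
          refine (le_abs_self _).trans ?_
          rw [← Real.norm_eq_abs]
          refine (norm_inner_le_norm _ _).trans ?_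
          simp only [Real.norm_eq_abs]
          rcases hval i with h | h
          · rw [h]; simp
          · rw [h]; simp
        · intro i _ hi
          simp only [S, Finset.mem_filter, Finset.mem_univ, true_and, not_not] at hi
          rw [hi]; simp
      have hcard : 0 < S.card := by
        rw [← ne_eq, ← norm_pos_iff, hn, Real.sqrt_pos] at hne
        exact_mod_cast hne
      calc ⟪R₁ - R₂, S₁ - S₂⟫ / (‖R₁ - R₂‖ * ‖S₁ - S₂‖)
          ≤ topAbsSum (R₁ - R₂) S.card / (Real.sqrt (S.card : ℝ) * ‖R₁ - R₂‖) := by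
            rw [hn, mul_comm]
            gcongr
            exact hin.trans (le_topAbs _ _)
        _ ≤ sSup C := by
            apply le_csSup hCf.bddAbove
            refine ⟨S.card, ?_, rfl⟩
            rw [Finset.mem_Icc]
            refine ⟨hcard, ?_⟩
            simpa using Finset.card_le_univ S

end helpers

/-- Theorem 2 of the paper: the average-case two-class accuracy, with `R₁, R₂` drawn
uniformly from the unit cube, equals the average of
`1 − arccos(max_{1≤j≤d} (Σ_{i=1}^j |R₁−R₂|_{(i)})/(√j ‖R₁−R₂‖))/π`. -/
theorem average_case_two_class_accuracy (d : ℕ) (hd : 1 ≤ d) :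
    (∫ R₁ in unitCube d, ∫ R₂ in unitCube d,
      sSup {b : ℝ | ∃ Rh₁ Rh₂ : EuclideanSpace ℝ (Fin d),
        (∀ i, Rh₁ i = 0 ∨ Rh₁ i = 1) ∧ (∀ i, Rh₂ i = 0 ∨ Rh₂ i = 1) ∧
        b = (unifBall d {r | ⟪R₁, r⟫ > ⟪R₂, r⟫ ∧ ⟪Rh₁, r⟫ > ⟪Rh₂, r⟫}).toReal +
            (unifBall d {r | ⟪R₂, r⟫ > ⟪R₁, r⟫ ∧ ⟪Rh₂, r⟫ > ⟪Rh₁, r⟫}).toReal}) =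
    (∫ R₁ in unitCube d, ∫ R₂ in unitCube d,
      1 - Real.arccos (sSup {c : ℝ | ∃ j ∈ Finset.Icc 1 d,
        c = topAbsSum (R₁ - R₂) j / (Real.sqrt (j : ℝ) * ‖R₁ - R₂‖)}) / Real.pi) := by
  have : Nonempty (Fin d) := ⟨⟨0, hd⟩⟩
  have : Nontrivial (EuclideanSpace ℝ (Fin d)) := inferInstance
  apply integral_congr_ae
  refine Filter.Eventually.of_forall fun R₁ => ?_
  apply integral_congr_ae
  apply ae_restrict_of_ae
  filter_upwards [Measure.ae_ne volume R₁] with R₂ hR₂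
  exact pointwise hd R₁ R₂ (sub_ne_zero.mpr hR₂.symm)
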